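/- Assume either (A4): γ_* ≥ 1 and S has at most finitely many zeros, or (A5): S is everywhere positive or everywhere negative on D. If limsup_{p→∞} O_p(f,D)/N^p = +∞, then the lower box dimension of the graph satisfies dim_B̲ Γf ≥ 1 + log ρ_*/log N, where ρ_* = lim_{n→∞} ρ(M̲_n). -/

import Mathlib

open scoped BigOperators

noncomputable def oscil (φ : ℝ × ℝ → ℝ) (E : Set (ℝ × ℝ)) : ℝ :=
  sSup ((fun p : (ℝ × ℝ) × (ℝ × ℝ) => φ p.1 - φ p.2) '' (E ×ˢ E))

noncomputable def eudist (s t : ℝ × ℝ) : ℝ :=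
  Real.sqrt ((s.1 - t.1) ^ 2 + (s.2 - t.2) ^ 2)

noncomputable def uMap (x0 len : ℝ) (N : ℕ) (i : Fin N) (x : ℝ) : ℝ :=
  if i.val % 2 = 0 then x0 + i.val * (len / N) + (x - x0) / N
  else x0 + (i.val + 1) * (len / N) - (x - x0) / N

noncomputable def uInv (x0 len : ℝ) (N : ℕ) (i : Fin N) (y : ℝ) : ℝ :=
  if i.val % 2 = 0 then x0 + N * (y - (x0 + i.val * (len / N)))
  else x0 + N * ((x0 + (i.val + 1) * (len / N)) - y)

noncomputable def Lmap (x0 y0 len : ℝ) (N : ℕ) (w : Fin N × Fin N) (t : ℝ × ℝ) : ℝ × ℝ :=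
  (uMap x0 len N w.1 t.1, uMap y0 len N w.2 t.2)

noncomputable def LInv (x0 y0 len : ℝ) (N : ℕ) (w : Fin N × Fin N) (t : ℝ × ℝ) : ℝ × ℝ :=
  (uInv x0 len N w.1 t.1, uInv y0 len N w.2 t.2)

noncomputable def sqD (x0 y0 len : ℝ) : Set (ℝ × ℝ) :=
  Set.Icc x0 (x0 + len) ×ˢ Set.Icc y0 (y0 + len)

noncomputable def cell (x0 y0 len : ℝ) (N : ℕ) : List (Fin N × Fin N) → Set (ℝ × ℝ)
  | [] => sqD x0 y0 len
  | w :: ws => Lmap x0 y0 len N w '' cell x0 y0 len N ws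

noncomputable def oscSum (x0 y0 len : ℝ) (N : ℕ) (φ : ℝ × ℝ → ℝ)
    (p : List (Fin N × Fin N)) (k : ℕ) : ℝ :=
  ∑ w : Fin k → Fin N × Fin N, oscil φ (cell x0 y0 len N (p ++ List.ofFn w))

noncomputable def supAbs (S : ℝ × ℝ → ℝ) (E : Set (ℝ × ℝ)) : ℝ :=
  sSup ((fun t => |S t|) '' E)

noncomputable def infAbs (S : ℝ × ℝ → ℝ) (E : Set (ℝ × ℝ)) : ℝ :=
  sInf ((fun t => |S t|) '' E)

open Classical in
noncomputable def upMat (x0 y0 len : ℝ) (N : ℕ) (S : ℝ × ℝ → ℝ) (m : ℕ) :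
    Matrix (Fin (m + 1) → Fin N × Fin N) (Fin (m + 1) → Fin N × Fin N) ℝ :=
  fun i j =>
    if ∀ k : Fin m, i k.succ = j k.castSucc then
      supAbs S (cell x0 y0 len N (List.ofFn i ++ [j (Fin.last m)]))
    else 0

open Classical in
noncomputable def lowMat (x0 y0 len : ℝ) (N : ℕ) (S : ℝ × ℝ → ℝ) (m : ℕ) :
    Matrix (Fin (m + 1) → Fin N × Fin N) (Fin (m + 1) → Fin N × Fin N) ℝ :=
  fun i j =>
    if ∀ k : Fin m, i k.succ = j k.castSucc then
      infAbs S (cell x0 y0 len N (List.ofFn i ++ [j (Fin.last m)]))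
    else 0

noncomputable def specRad {α : Type*} [Fintype α] [DecidableEq α] (A : Matrix α α ℝ) : ENNReal :=
  spectralRadius ℂ (A.map (fun x : ℝ => (x : ℂ)))

noncomputable def cubeCount (E : Set (ℝ × ℝ × ℝ)) (ε : ℝ) : ℕ :=
  Nat.card {n : ℤ × ℤ × ℤ |
    (((Set.Icc ((n.1 : ℝ) * ε) (((n.1 : ℝ) + 1) * ε)) ×ˢ
      ((Set.Icc ((n.2.1 : ℝ) * ε) (((n.2.1 : ℝ) + 1) * ε)) ×ˢ
        (Set.Icc ((n.2.2 : ℝ) * ε) (((n.2.2 : ℝ) + 1) * ε)))) ∩ E).Nonempty}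

noncomputable def ubDim (E : Set (ℝ × ℝ × ℝ)) : ℝ :=
  Filter.limsup (fun ε : ℝ => Real.log (cubeCount E ε) / Real.log (1 / ε))
    (nhdsWithin 0 (Set.Ioi 0))

noncomputable def lbDim (E : Set (ℝ × ℝ × ℝ)) : ℝ :=
  Filter.liminf (fun ε : ℝ => Real.log (cubeCount E ε) / Real.log (1 / ε))
    (nhdsWithin 0 (Set.Ioi 0))

def graphOn (f : ℝ × ℝ → ℝ) (D : Set (ℝ × ℝ)) : Set (ℝ × ℝ × ℝ) :=
  {p | (p.1, p.2.1) ∈ D ∧ p.2.2 = f (p.1, p.2.1)}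

section UnitMaps

variable {x0 len : ℝ} {N : ℕ}

theorem uMap_mem_subinterval (i : Fin N) {x : ℝ}
    (hx : x ∈ Set.Icc x0 (x0 + len)) :
    x0 + i.val * (len / N) ≤ uMap x0 len N i x ∧
      uMap x0 len N i x ≤ x0 + (i.val + 1) * (len / N) := by
  have hN : (0 : ℝ) < N := by exact_mod_cast i.pos
  have h1 : 0 ≤ (x - x0) / N := div_nonneg (by linarith [hx.1]) hN.le
  have h2 : (x - x0) / N ≤ len / N := by gcongr; linarith [hx.2]
  unfold uMap
  split_ifs <;> constructor <;> linarith

theorem uMap_mem_Icc (hlen : 0 < len) (i : Fin N) {x : ℝ}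
    (hx : x ∈ Set.Icc x0 (x0 + len)) : uMap x0 len N i x ∈ Set.Icc x0 (x0 + len) := by
  have hN : (0 : ℝ) < N := by exact_mod_cast i.pos
  obtain ⟨h1, h2⟩ := uMap_mem_subinterval i hx
  have hi : (i.val : ℝ) + 1 ≤ N := by exact_mod_cast i.isLt
  have h3 : ((i.val : ℝ) + 1) * (len / N) ≤ N * (len / N) := by gcongr
  have h4 : (N : ℝ) * (len / N) = len := by field_simp
  have h5 : 0 ≤ (i.val : ℝ) * (len / N) := by positivity
  exact ⟨by linarith, by linarith⟩

theorem uInv_uMap (i : Fin N) (x : ℝ) : uInv x0 len N i (uMap x0 len N i x) = x := by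
  have hN : (0 : ℝ) < N := by exact_mod_cast i.pos
  unfold uInv uMap
  split_ifs <;> field_simp <;> ring

theorem continuous_uMap (i : Fin N) : Continuous (uMap x0 len N i) := by
  unfold uMap
  split_ifs <;> fun_prop

/-- Two different branches only meet at a common endpoint of adjacent subintervals. -/
theorem uMap_eq_uMap_of_lt (hlen : 0 < len) {a b : Fin N} (hab : a < b) {x y : ℝ}
    (hx : x ∈ Set.Icc x0 (x0 + len)) (hy : y ∈ Set.Icc x0 (x0 + len))
    (h : uMap x0 len N a x = uMap x0 len N b y) :
    x = y ∧ (x = x0 ∨ x = x0 + len) ∧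
      x0 < uMap x0 len N a x ∧ uMap x0 len N a x < x0 + len := by
  have hN : (0 : ℝ) < N := by exact_mod_cast a.pos
  have hh : 0 < len / N := by positivity
  obtain ⟨ha1, ha2⟩ := uMap_mem_subinterval a hx
  obtain ⟨hb1, hb2⟩ := uMap_mem_subinterval b hy
  have hle : (a.val : ℝ) + 1 ≤ b.val := by exact_mod_cast hab
  have hmul : ((a.val : ℝ) + 1) * (len / N) ≤ b.val * (len / N) := by gcongr
  have hb : (b.val : ℝ) = a.val + 1 := by
    by_contra hne
    have : ((a.val : ℝ) + 1) * (len / N) < b.val * (len / N) := by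
      gcongr
      exact lt_of_le_of_ne hle (Ne.symm hne)
    linarith
  have hval : uMap x0 len N a x = x0 + (a.val + 1) * (len / N) :=
    le_antisymm ha2 (by linarith)
  have hbN : (b.val : ℝ) < N := by exact_mod_cast b.isLt
  have hlt : ((a.val : ℝ) + 1) * (len / N) < N * (len / N) := by
    rw [← hb]; gcongr
  have h4 : (N : ℝ) * (len / N) = len := by field_simp
  have hpos : 0 < ((a.val : ℝ) + 1) * (len / N) := by positivity
  have hbn : b.val = a.val + 1 := by exact_mod_cast hb
  have hvalb := h.symm.trans hval
  have key : (x = x0 ∧ y = x0) ∨ (x = x0 + len ∧ y = x0 + len) := by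
    unfold uMap at hval hvalb
    rw [hbn] at hvalb
    push_cast at hvalb
    by_cases hpar : a.val % 2 = 0
    · rw [if_pos hpar] at hval
      rw [if_neg (by omega)] at hvalb
      right
      constructor
      · have : (x - x0) / N = len / N := by linarith
        have := (div_left_inj' hN.ne').1 this
        linarith
      · have : (y - x0) / N = len / N := by linarith
        have := (div_left_inj' hN.ne').1 this
        linarith
    · rw [if_neg hpar] at hval
      rw [if_pos (by omega)] at hvalb
      left
      constructor
      · have : (x - x0) / N = 0 := by linarith
        have := (div_eq_zero_iff.1 this).resolve_right hN.ne'
        linarith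
      · have : (y - x0) / N = 0 := by linarith
        have := (div_eq_zero_iff.1 this).resolve_right hN.ne'
        linarith
  refine ⟨?_, ?_, by linarith, by linarith⟩
  · rcases key with ⟨h1, h2⟩ | ⟨h1, h2⟩ <;> rw [h1, h2]
  · rcases key with ⟨h1, -⟩ | ⟨h1, -⟩ <;> simp [h1]

theorem uMap_eq_uMap_of_ne (hlen : 0 < len) {a b : Fin N} (hab : a ≠ b) {x y : ℝ}
    (hx : x ∈ Set.Icc x0 (x0 + len)) (hy : y ∈ Set.Icc x0 (x0 + len))
    (h : uMap x0 len N a x = uMap x0 len N b y) :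
    x = y ∧ (x = x0 ∨ x = x0 + len) ∧
      x0 < uMap x0 len N a x ∧ uMap x0 len N a x < x0 + len := by
  rcases lt_or_gt_of_ne hab with hlt | hlt
  · exact uMap_eq_uMap_of_lt hlen hlt hx hy h
  · obtain ⟨h1, h2, h3, h4⟩ := uMap_eq_uMap_of_lt hlen hlt hy hx h.symm
    rw [← h] at h3 h4
    exact ⟨h1.symm, by rwa [← h1], h3, h4⟩

theorem eq_of_uMap_eq_uMap (hlen : 0 < len) {a b : Fin N} {x y : ℝ}
    (hx : x ∈ Set.Icc x0 (x0 + len)) (hy : y ∈ Set.Icc x0 (x0 + len))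
    (h : uMap x0 len N a x = uMap x0 len N b y) : x = y := by
  by_cases hab : a = b
  · subst hab
    rw [← uInv_uMap (x0 := x0) (len := len) a x, h, uInv_uMap]
  · exact (uMap_eq_uMap_of_ne hlen hab hx hy h).1

theorem endpoint_of_uMap_endpoint (hlen : 0 < len) (a : Fin N) {x : ℝ}
    (hx : x ∈ Set.Icc x0 (x0 + len))
    (h : uMap x0 len N a x = x0 ∨ uMap x0 len N a x = x0 + len) :
    x = x0 ∨ x = x0 + len := by
  have hN : (0 : ℝ) < N := by exact_mod_cast a.pos
  by_contra! hne
  have h1 : 0 < (x - x0) / N := div_pos (by linarith [lt_of_le_of_ne hx.1 hne.1.symm]) hN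
  have h2 : (x - x0) / N < len / N := by
    gcongr; linarith [lt_of_le_of_ne hx.2 hne.2]
  have hi : (a.val : ℝ) + 1 ≤ N := by exact_mod_cast a.isLt
  have h3 : ((a.val : ℝ) + 1) * (len / N) ≤ N * (len / N) := by gcongr
  have h4 : (N : ℝ) * (len / N) = len := by field_simp
  have h5 : 0 ≤ (a.val : ℝ) * (len / N) := by positivity
  unfold uMap at h
  split_ifs at h <;> rcases h with h | h <;> linarith

/-- Position, counted from the left, of the subinterval of generation `l.length` coded by `l`. -/
def gridIdx {N : ℕ} : List (Fin N) → ℕ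
  | [] => 0
  | a :: l => if a.val % 2 = 0 then a.val * N ^ l.length + gridIdx l
      else (a.val + 1) * N ^ l.length - 1 - gridIdx l

theorem gridIdx_lt : ∀ l : List (Fin N), gridIdx l < N ^ l.length
  | [] => by simp [gridIdx]
  | a :: l => by
    have ih := gridIdx_lt l
    have h1 : (a.val + 1) * N ^ l.length ≤ N ^ (l.length + 1) := by
      rw [pow_succ, mul_comm]
      exact Nat.mul_le_mul_left _ a.isLt
    have h2 : (a.val + 1) * N ^ l.length = a.val * N ^ l.length + N ^ l.length := by ring
    simp only [gridIdx, List.length_cons]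
    split_ifs <;> omega

theorem gridIdx_cons_div (a : Fin N) (l : List (Fin N)) :
    gridIdx (a :: l) / N ^ l.length = a.val := by
  have ih := gridIdx_lt l
  have h2 : (a.val + 1) * N ^ l.length = a.val * N ^ l.length + N ^ l.length := by ring
  rw [Nat.div_eq_iff (by omega)]
  simp only [gridIdx]
  split_ifs <;> omega

theorem gridIdx_injective : ∀ {l l' : List (Fin N)}, l.length = l'.length →
    gridIdx l = gridIdx l' → l = l'
  | [], [], _, _ => rfl
  | [], _ :: _, h, _ => by simp at h
  | _ :: _, [], h, _ => by simp at h
  | a :: l, b :: l', h, h' => by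
    have hl : l.length = l'.length := by simpa using h
    have hab : a = b := by
      apply Fin.ext
      rw [← gridIdx_cons_div a l, ← gridIdx_cons_div b l', h', hl]
    subst hab
    have h1 := gridIdx_lt l
    have h2 := gridIdx_lt l'
    have h3 : (a.val + 1) * N ^ l.length = a.val * N ^ l.length + N ^ l.length := by ring
    have : gridIdx l = gridIdx l' := by
      simp only [gridIdx, ← hl] at h'
      rw [← hl] at h2
      split_ifs at h' <;> omega
    rw [gridIdx_injective hl this]

theorem uMap_mem_grid (a : Fin N) (l : List (Fin N)) {x : ℝ}
    (h1 : x0 + gridIdx l * (len / N ^ l.length) ≤ x)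
    (h2 : x ≤ x0 + (gridIdx l + 1) * (len / N ^ l.length)) :
    x0 + gridIdx (a :: l) * (len / N ^ (a :: l).length) ≤ uMap x0 len N a x ∧
      uMap x0 len N a x ≤ x0 + (gridIdx (a :: l) + 1) * (len / N ^ (a :: l).length) := by
  have hN : (0 : ℝ) < N := by exact_mod_cast a.pos
  have ih := gridIdx_lt l
  have e1 : gridIdx l * (len / N ^ l.length) / N = gridIdx l * (len / N ^ (l.length + 1)) := by
    rw [pow_succ]; field_simp
  have e2 : (gridIdx l + 1) * (len / N ^ l.length) / N =
      (gridIdx l + 1) * (len / N ^ (l.length + 1)) := by rw [pow_succ]; field_simp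
  have e3 : len / N = N ^ l.length * (len / N ^ (l.length + 1)) := by
    rw [pow_succ]; field_simp
  have b1 : gridIdx l * (len / N ^ (l.length + 1)) ≤ (x - x0) / N := by
    rw [← e1]; gcongr; linarith
  have b2 : (x - x0) / N ≤ (gridIdx l + 1) * (len / N ^ (l.length + 1)) := by
    rw [← e2]; gcongr; linarith
  rw [List.length_cons]
  unfold uMap
  by_cases hpar : a.val % 2 = 0
  · have hg : (gridIdx (a :: l) : ℝ) = a.val * N ^ l.length + gridIdx l := by
      simp [gridIdx, hpar]
    rw [if_pos hpar, hg, e3]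
    constructor <;> nlinarith
  · have hg : (gridIdx (a :: l) : ℝ) = (a.val + 1) * N ^ l.length - 1 - gridIdx l := by
      have hle : gridIdx l + 1 ≤ (a.val + 1) * N ^ l.length :=
        ih.trans_le (Nat.le_mul_of_pos_left _ (by omega))
      have : gridIdx (a :: l) + (gridIdx l + 1) = (a.val + 1) * N ^ l.length := by
        simp only [gridIdx, if_neg hpar]
        omega
      have h' : (gridIdx (a :: l) : ℝ) + (gridIdx l + 1) = (a.val + 1) * N ^ l.length := by
        exact_mod_cast this
      linarith
    rw [if_neg hpar, hg, e3]
    constructor <;> nlinarith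

end UnitMaps

section Cells

variable {x0 y0 len : ℝ} {N : ℕ}

theorem Lmap_mem_sqD (hlen : 0 < len) (w : Fin N × Fin N) {t : ℝ × ℝ}
    (ht : t ∈ sqD x0 y0 len) : Lmap x0 y0 len N w t ∈ sqD x0 y0 len :=
  ⟨uMap_mem_Icc hlen w.1 ht.1, uMap_mem_Icc hlen w.2 ht.2⟩

theorem LInv_Lmap (w : Fin N × Fin N) (t : ℝ × ℝ) :
    LInv x0 y0 len N w (Lmap x0 y0 len N w t) = t :=
  Prod.ext (uInv_uMap w.1 t.1) (uInv_uMap w.2 t.2)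

theorem Lmap_injective (w : Fin N × Fin N) : Function.Injective (Lmap x0 y0 len N w) :=
  Function.LeftInverse.injective (LInv_Lmap w)

theorem continuous_Lmap (w : Fin N × Fin N) : Continuous (Lmap x0 y0 len N w) :=
  ((continuous_uMap w.1).comp continuous_fst).prodMk ((continuous_uMap w.2).comp continuous_snd)

theorem cell_subset_sqD (hlen : 0 < len) :
    ∀ w : List (Fin N × Fin N), cell x0 y0 len N w ⊆ sqD x0 y0 len
  | [] => subset_rfl
  | a :: w => by
    rintro _ ⟨t, ht, rfl⟩
    exact Lmap_mem_sqD hlen a (cell_subset_sqD hlen w ht)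

theorem isCompact_cell : ∀ w : List (Fin N × Fin N), IsCompact (cell x0 y0 len N w)
  | [] => isCompact_Icc.prod isCompact_Icc
  | a :: w => (isCompact_cell w).image (continuous_Lmap a)

theorem isConnected_cell (hlen : 0 < len) :
    ∀ w : List (Fin N × Fin N), IsConnected (cell x0 y0 len N w)
  | [] => (isConnected_Icc (by linarith)).prod (isConnected_Icc (by linarith))
  | a :: w => (isConnected_cell hlen w).image _ (continuous_Lmap a).continuousOn

theorem cell_append_subset (hlen : 0 < len) :
    ∀ w v : List (Fin N × Fin N), cell x0 y0 len N (w ++ v) ⊆ cell x0 y0 len N w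
  | [], v => cell_subset_sqD hlen v
  | _ :: w, v => Set.image_mono (cell_append_subset hlen w v)

theorem mem_cell_grid : ∀ (w : List (Fin N × Fin N)) {t : ℝ × ℝ}, t ∈ cell x0 y0 len N w →
    (x0 + gridIdx (w.map Prod.fst) * (len / N ^ w.length) ≤ t.1 ∧
      t.1 ≤ x0 + (gridIdx (w.map Prod.fst) + 1) * (len / N ^ w.length)) ∧
    (y0 + gridIdx (w.map Prod.snd) * (len / N ^ w.length) ≤ t.2 ∧
      t.2 ≤ y0 + (gridIdx (w.map Prod.snd) + 1) * (len / N ^ w.length))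
  | [], t, ht => by
    obtain ⟨⟨h1, h2⟩, h3, h4⟩ := ht
    simp [gridIdx, h1, h2, h3, h4]
  | a :: w, _, ⟨t, ht, rfl⟩ => by
    obtain ⟨h1, h2⟩ := mem_cell_grid w ht
    have e1 := uMap_mem_grid (x0 := x0) (len := len) a.1 (w.map Prod.fst)
      (by simpa using h1.1) (by simpa using h1.2)
    have e2 := uMap_mem_grid (x0 := y0) (len := len) a.2 (w.map Prod.snd)
      (by simpa using h2.1) (by simpa using h2.2)
    simp only [List.length_cons, List.length_map] at e1 e2
    exact ⟨e1, e2⟩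

theorem eudist_le_add_abs (s t : ℝ × ℝ) : eudist s t ≤ |s.1 - t.1| + |s.2 - t.2| := by
  unfold eudist
  rw [Real.sqrt_le_left (by positivity), ← sq_abs (s.1 - t.1), ← sq_abs (s.2 - t.2)]
  nlinarith [mul_nonneg (abs_nonneg (s.1 - t.1)) (abs_nonneg (s.2 - t.2))]

theorem eudist_le_of_mem_cell (w : List (Fin N × Fin N)) {s t : ℝ × ℝ}
    (hs : s ∈ cell x0 y0 len N w) (ht : t ∈ cell x0 y0 len N w) :
    eudist s t ≤ 2 * len / N ^ w.length := by
  obtain ⟨⟨a1, a2⟩, a3, a4⟩ := mem_cell_grid w hs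
  obtain ⟨⟨b1, b2⟩, b3, b4⟩ := mem_cell_grid w ht
  have h1 : |s.1 - t.1| ≤ len / N ^ w.length := by rw [abs_le]; constructor <;> linarith
  have h2 : |s.2 - t.2| ≤ len / N ^ w.length := by rw [abs_le]; constructor <;> linarith
  calc eudist s t ≤ |s.1 - t.1| + |s.2 - t.2| := eudist_le_add_abs s t
    _ ≤ 2 * len / N ^ w.length := by rw [mul_div_assoc]; linarith

end Cells

section Oscillation

theorem le_oscil {φ : ℝ × ℝ → ℝ} {E : Set (ℝ × ℝ)} (hE : IsCompact E) (hφ : ContinuousOn φ E)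
    {s t : ℝ × ℝ} (hs : s ∈ E) (ht : t ∈ E) : φ s - φ t ≤ oscil φ E := by
  refine le_csSup ?_ ⟨(s, t), ⟨hs, ht⟩, rfl⟩
  refine ((hE.prod hE).image_of_continuousOn ?_).bddAbove
  exact (hφ.comp continuousOn_fst fun _ h => h.1).sub (hφ.comp continuousOn_snd fun _ h => h.2)

theorem oscil_le {φ : ℝ × ℝ → ℝ} {E : Set (ℝ × ℝ)} (hE : E.Nonempty) {C : ℝ}
    (h : ∀ s ∈ E, ∀ t ∈ E, φ s - φ t ≤ C) : oscil φ E ≤ C := by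
  refine csSup_le ((hE.prod hE).image _) ?_
  rintro _ ⟨⟨s, t⟩, ⟨hs, ht⟩, rfl⟩
  exact h s hs t ht

theorem oscil_nonneg {φ : ℝ × ℝ → ℝ} {E : Set (ℝ × ℝ)} : 0 ≤ oscil φ E := by
  by_cases hb : BddAbove ((fun p : (ℝ × ℝ) × (ℝ × ℝ) => φ p.1 - φ p.2) '' (E ×ˢ E))
  · rcases E.eq_empty_or_nonempty with rfl | ⟨s, hs⟩
    · simp [oscil]
    · exact le_csSup hb ⟨(s, s), ⟨hs, hs⟩, by simp⟩
  · exact (Real.sSup_of_not_bddAbove hb).ge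

variable {x0 y0 len : ℝ} {N : ℕ}

theorem oscSum_nonneg (φ : ℝ × ℝ → ℝ) (w : List (Fin N × Fin N)) (k : ℕ) :
    0 ≤ oscSum x0 y0 len N φ w k :=
  Finset.sum_nonneg fun _ _ => oscil_nonneg

theorem oscSum_succ (φ : ℝ × ℝ → ℝ) (w : List (Fin N × Fin N)) (k : ℕ) :
    oscSum x0 y0 len N φ w (k + 1) =
      ∑ a : Fin N × Fin N, oscSum x0 y0 len N φ (w ++ [a]) k := by
  unfold oscSum
  rw [← (Fin.consEquiv fun _ => Fin N × Fin N).sum_comp, Fintype.sum_prod_type]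
  simp [Fin.consEquiv, List.ofFn_succ]

theorem oscSum_append_le (φ : ℝ × ℝ → ℝ) (w : List (Fin N × Fin N)) (a : Fin N × Fin N) (k : ℕ) :
    oscSum x0 y0 len N φ (w ++ [a]) k ≤ oscSum x0 y0 len N φ w (k + 1) := by
  rw [oscSum_succ]
  exact Finset.single_le_sum (f := fun b : Fin N × Fin N => oscSum x0 y0 len N φ (w ++ [b]) k)
    (fun _ _ => oscSum_nonneg _ _ _) (Finset.mem_univ a)

theorem oscSum_add (φ : ℝ × ℝ → ℝ) (k : ℕ) : ∀ (m : ℕ) (w : List (Fin N × Fin N)),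
    oscSum x0 y0 len N φ w (m + k) =
      ∑ i : Fin m → Fin N × Fin N, oscSum x0 y0 len N φ (w ++ List.ofFn i) k
  | 0, w => by simp
  | m + 1, w => by
    rw [show m + 1 + k = m + k + 1 by ring, oscSum_succ]
    conv_rhs => rw [← (Fin.consEquiv fun _ => Fin N × Fin N).sum_comp, Fintype.sum_prod_type]
    refine Finset.sum_congr rfl fun a _ => ?_
    rw [oscSum_add φ k m]
    simp [Fin.consEquiv, List.ofFn_succ]

end Oscillation

section Scaling

variable {x0 y0 len : ℝ} {N : ℕ} {f S q : ℝ × ℝ → ℝ}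

/-- Prepending the letter `a` to a word scales the oscillation sums by at least any lower bound
`s` of `|S|` on the new cell, up to an error of order `N ^ p`. -/
def OscSumScaling (x0 y0 len : ℝ) (N : ℕ) (f S : ℝ × ℝ → ℝ) (K : ℝ) : Prop :=
  ∀ (a : Fin N × Fin N) (w : List (Fin N × Fin N)) (s : ℝ) (p : ℕ), 0 ≤ s →
    (∀ t ∈ cell x0 y0 len N (a :: w), s ≤ |S t|) →
    s * oscSum x0 y0 len N f w p ≤ oscSum x0 y0 len N f (a :: w) p + K * (N : ℝ) ^ p

theorem mul_oscil_le (hlen : 0 < len) {lamS lamq B : ℝ} (hlamS : 0 ≤ lamS) (hlamq : 0 ≤ lamq)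
    (hf : ContinuousOn f (sqD x0 y0 len))
    (hB : ∀ t ∈ sqD x0 y0 len, |f t| ≤ B)
    (hSlip : ∀ t₁ ∈ sqD x0 y0 len, ∀ t₂ ∈ sqD x0 y0 len, |S t₁ - S t₂| ≤ lamS * eudist t₁ t₂)
    (hqlip : ∀ t₁ ∈ sqD x0 y0 len, ∀ t₂ ∈ sqD x0 y0 len, |q t₁ - q t₂| ≤ lamq * eudist t₁ t₂)
    (hself : ∀ w : Fin N × Fin N, ∀ t ∈ cell x0 y0 len N [w],
      f t = S t * f (LInv x0 y0 len N w t) + q t)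
    (a : Fin N × Fin N) (v : List (Fin N × Fin N)) {s : ℝ} (hs : 0 ≤ s)
    (hsS : ∀ t ∈ cell x0 y0 len N (a :: v), s ≤ |S t|) :
    s * oscil f (cell x0 y0 len N v) ≤ oscil f (cell x0 y0 len N (a :: v)) +
      (lamS * B + lamq) * (2 * len) / N ^ v.length := by
  have hN : (1 : ℝ) ≤ N := by exact_mod_cast a.1.pos
  have hD := cell_subset_sqD (x0 := x0) (y0 := y0) (N := N) hlen
  have hne := isConnected_cell (x0 := x0) (y0 := y0) (N := N) hlen
  have hcore : ∀ x ∈ cell x0 y0 len N v, ∀ y ∈ cell x0 y0 len N v,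
      s * (f x - f y) ≤ oscil f (cell x0 y0 len N (a :: v)) +
        (lamS * B + lamq) * (2 * len) / N ^ v.length := by
    intro x hx y hy
    set X := Lmap x0 y0 len N a x with hXdef
    set Y := Lmap x0 y0 len N a y with hYdef
    have hX : X ∈ cell x0 y0 len N (a :: v) := ⟨x, hx, rfl⟩
    have hY : Y ∈ cell x0 y0 len N (a :: v) := ⟨y, hy, rfl⟩
    have hfX : f X = S X * f x + q X := by
      have := hself a X ⟨x, hD _ hx, rfl⟩
      rwa [hXdef, LInv_Lmap] at this
    have hfY : f Y = S Y * f y + q Y := by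
      have := hself a Y ⟨y, hD _ hy, rfl⟩
      rwa [hYdef, LInv_Lmap] at this
    have hosc : |f X - f Y| ≤ oscil f (cell x0 y0 len N (a :: v)) := by
      have hc := hf.mono (hD (a :: v))
      rw [abs_le]
      constructor
      · linarith [le_oscil (isCompact_cell _) hc hY hX]
      · exact le_oscil (isCompact_cell _) hc hX hY
    have hdist : eudist X Y ≤ 2 * len / N ^ v.length := by
      refine (eudist_le_of_mem_cell _ hX hY).trans ?_
      rw [List.length_cons]
      gcongr
      exact Nat.le_succ _
    have hd0 : 0 ≤ eudist X Y := Real.sqrt_nonneg _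
    have hS' := hSlip X (hD _ hX) Y (hD _ hY)
    have hq' := hqlip X (hD _ hX) Y (hD _ hY)
    have hB' := hB y (hD _ hy)
    have hB0 : 0 ≤ B := (abs_nonneg _).trans hB'
    have h1 : |S X| * |f x - f y| ≤ |f X - f Y| + |S X - S Y| * |f y| + |q X - q Y| := by
      rw [← abs_mul, ← abs_mul]
      have : S X * (f x - f y) = (f X - f Y) - (S X - S Y) * f y - (q X - q Y) := by
        rw [hfX, hfY]; ring
      rw [this]
      exact (abs_sub _ _).trans (add_le_add_left (abs_sub _ _) _)
    have h2 : |S X - S Y| * |f y| ≤ lamS * eudist X Y * B := by gcongr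
    have h3 : s * (f x - f y) ≤ |S X| * |f x - f y| :=
      (mul_le_mul_of_nonneg_left (le_abs_self _) hs).trans
        (mul_le_mul_of_nonneg_right (hsS X hX) (abs_nonneg _))
    have h4 : (lamS * B + lamq) * eudist X Y ≤ (lamS * B + lamq) * (2 * len / N ^ v.length) := by
      gcongr
    rw [mul_div_assoc]
    linarith
  rcases hs.eq_or_lt with rfl | hs
  · obtain ⟨x, hx⟩ := (hne v).nonempty
    simpa using hcore x hx x hx
  · rw [← le_div_iff₀' hs]
    refine oscil_le (hne v).nonempty fun x hx y hy => ?_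
    rw [le_div_iff₀' hs]
    exact hcore x hx y hy

theorem exists_oscSumScaling (hlen : 0 < len) {lamS lamq : ℝ} (hlamS : 0 ≤ lamS)
    (hlamq : 0 ≤ lamq) (hf : ContinuousOn f (sqD x0 y0 len))
    (hSlip : ∀ t₁ ∈ sqD x0 y0 len, ∀ t₂ ∈ sqD x0 y0 len, |S t₁ - S t₂| ≤ lamS * eudist t₁ t₂)
    (hqlip : ∀ t₁ ∈ sqD x0 y0 len, ∀ t₂ ∈ sqD x0 y0 len, |q t₁ - q t₂| ≤ lamq * eudist t₁ t₂)
    (hself : ∀ w : Fin N × Fin N, ∀ t ∈ cell x0 y0 len N [w],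
      f t = S t * f (LInv x0 y0 len N w t) + q t) :
    ∃ K, 0 ≤ K ∧ OscSumScaling x0 y0 len N f S K := by
  obtain ⟨B, hB⟩ := (isCompact_Icc.prod isCompact_Icc).exists_bound_of_continuousOn hf
  have hB0 : 0 ≤ B := (norm_nonneg _).trans
    (hB (x0, y0) ⟨⟨le_rfl, by simpa using hlen.le⟩, ⟨le_rfl, by simpa using hlen.le⟩⟩)
  refine ⟨(lamS * B + lamq) * (2 * len), by positivity, fun a w s p hs hsS => ?_⟩
  have hN : (1 : ℝ) ≤ N := by exact_mod_cast a.1.pos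
  have hN0 : (N : ℝ) ≠ 0 := by positivity
  have hK : 0 ≤ (lamS * B + lamq) * (2 * len) := by positivity
  unfold oscSum
  have hsum : ∑ _v : Fin p → Fin N × Fin N, (lamS * B + lamq) * (2 * len) / (N : ℝ) ^ p =
      (lamS * B + lamq) * (2 * len) * (N : ℝ) ^ p := by
    simp [mul_pow]
    field_simp
  rw [Finset.mul_sum, ← hsum, ← Finset.sum_add_distrib]
  refine Finset.sum_le_sum fun v _ => ?_
  have := mul_oscil_le hlen hlamS hlamq hf hB hSlip hqlip hself a (w ++ List.ofFn v) hs
    fun t ht => hsS t (cell_append_subset hlen (a :: w) _ ht)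
  refine this.trans ?_
  rw [List.cons_append]
  gcongr
  simp

end Scaling

section Rough

variable {x0 y0 len : ℝ} {N : ℕ} {f S : ℝ × ℝ → ℝ}

/-- The normalized oscillation sums of `f` over the cell coded by `w` are unbounded. -/
def IsRough (x0 y0 len : ℝ) (N : ℕ) (f : ℝ × ℝ → ℝ) (w : List (Fin N × Fin N)) : Prop :=
  ∀ C : ℝ, ∃ p : ℕ, C * (N : ℝ) ^ p < oscSum x0 y0 len N f w p

theorem IsRough.exists_append {w : List (Fin N × Fin N)} (h : IsRough x0 y0 len N f w) :
    ∃ a, IsRough x0 y0 len N f (w ++ [a]) := by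
  by_contra hno
  unfold IsRough at hno
  push Not at hno
  choose C hC using hno
  obtain ⟨p, hp⟩ := h (max (oscSum x0 y0 len N f w 0) (∑ a, max (C a) 0))
  rcases p with _ | p
  · simp at hp
  · rcases isEmpty_or_nonempty (Fin N × Fin N) with hE | ⟨⟨a, -⟩⟩
    · have h0 : oscSum x0 y0 len N f w (p + 1) = 0 := by rw [oscSum_succ]; simp
      have : 0 ≤ max (oscSum x0 y0 len N f w 0) (∑ a, max (C a) 0) * (N : ℝ) ^ (p + 1) := by
        have := oscSum_nonneg (x0 := x0) (y0 := y0) (len := len) f w 0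
        have := this.trans (le_max_left _ (∑ a, max (C a) 0))
        positivity
      linarith
    have hN : (1 : ℝ) ≤ N := by exact_mod_cast a.pos
    have hc : 0 ≤ ∑ a, max (C a) 0 := Finset.sum_nonneg fun _ _ => le_max_right _ _
    have h1 : oscSum x0 y0 len N f w (p + 1) ≤ (∑ a, max (C a) 0) * (N : ℝ) ^ p := by
      rw [oscSum_succ, Finset.sum_mul]
      refine Finset.sum_le_sum fun a _ => (hC a p).trans ?_
      gcongr
      exact le_max_left _ _
    have h2 : (∑ a, max (C a) 0) * (N : ℝ) ^ p ≤
        max (oscSum x0 y0 len N f w 0) (∑ a, max (C a) 0) * (N : ℝ) ^ (p + 1) := by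
      gcongr
      · exact le_max_right _ _
      · omega
    linarith

theorem IsRough.of_append_singleton {w : List (Fin N × Fin N)} {a : Fin N × Fin N}
    (h : IsRough x0 y0 len N f (w ++ [a])) : IsRough x0 y0 len N f w := by
  intro C
  have hN : (0 : ℝ) < N := by exact_mod_cast a.1.pos
  obtain ⟨p, hp⟩ := h (C * N)
  refine ⟨p + 1, lt_of_lt_of_le ?_ (oscSum_append_le f w a p)⟩
  rw [pow_succ]
  linarith

theorem IsRough.of_append {w : List (Fin N × Fin N)} :
    ∀ {v : List (Fin N × Fin N)}, IsRough x0 y0 len N f (w ++ v) → IsRough x0 y0 len N f w := by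
  intro v
  induction v using List.reverseRecOn with
  | nil => simp
  | append_singleton v a ih =>
    rw [← List.append_assoc]
    exact fun h => ih h.of_append_singleton

theorem IsRough.cons {K : ℝ} (hsc : OscSumScaling x0 y0 len N f S K) {w : List (Fin N × Fin N)}
    (h : IsRough x0 y0 len N f w) {a : Fin N × Fin N} {s : ℝ} (hs : 0 < s)
    (hS : ∀ t ∈ cell x0 y0 len N (a :: w), s ≤ |S t|) : IsRough x0 y0 len N f (a :: w) := by
  intro C
  obtain ⟨p, hp⟩ := h ((C + K) / s)
  refine ⟨p, ?_⟩
  have h1 := hsc a w s p hs.le hS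
  have h2 := mul_lt_mul_of_pos_left hp hs
  have h3 : s * ((C + K) / s * (N : ℝ) ^ p) = (C + K) * (N : ℝ) ^ p := by field_simp
  linarith

/-- Composition of the maps `Lmap` along a word. -/
noncomputable def wordMap (x0 y0 len : ℝ) (N : ℕ) (w : List (Fin N × Fin N)) (t : ℝ × ℝ) : ℝ × ℝ :=
  w.foldr (Lmap x0 y0 len N) t

theorem wordMap_injective : ∀ w : List (Fin N × Fin N),
    Function.Injective (wordMap x0 y0 len N w)
  | [] => fun _ _ h => h
  | a :: w => (Lmap_injective a).comp (wordMap_injective w)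

theorem wordMap_mem_cell_append {t : ℝ × ℝ} {v : List (Fin N × Fin N)}
    (ht : t ∈ cell x0 y0 len N v) :
    ∀ w : List (Fin N × Fin N), wordMap x0 y0 len N w t ∈ cell x0 y0 len N (w ++ v)
  | [] => ht
  | _ :: w => ⟨_, wordMap_mem_cell_append ht w, rfl⟩

/-- Arbitrarily deep cells around `x` become rough when `v` is prepended to their words. -/
def RoughAt (x0 y0 len : ℝ) (N : ℕ) (f : ℝ × ℝ → ℝ) (v : List (Fin N × Fin N)) (x : ℝ × ℝ) :
    Prop :=
  ∀ k : ℕ, ∃ w : List (Fin N × Fin N), k ≤ w.length ∧ x ∈ cell x0 y0 len N w ∧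
    IsRough x0 y0 len N f (v ++ w)

theorem RoughAt.isRough {v : List (Fin N × Fin N)} {x : ℝ × ℝ}
    (h : RoughAt x0 y0 len N f v x) : IsRough x0 y0 len N f v :=
  let ⟨_, _, _, hw⟩ := h 0
  hw.of_append

theorem RoughAt.mem_sqD (hlen : 0 < len) {v : List (Fin N × Fin N)} {x : ℝ × ℝ}
    (h : RoughAt x0 y0 len N f v x) : x ∈ sqD x0 y0 len :=
  let ⟨w, _, hx, _⟩ := h 0
  cell_subset_sqD hlen w hx

theorem RoughAt.cons (hlen : 0 < len) (hN : 2 ≤ N) {K lamS : ℝ}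
    (hsc : OscSumScaling x0 y0 len N f S K) (hlamS : 0 < lamS)
    (hSlip : ∀ t₁ ∈ sqD x0 y0 len, ∀ t₂ ∈ sqD x0 y0 len, |S t₁ - S t₂| ≤ lamS * eudist t₁ t₂)
    {v : List (Fin N × Fin N)} {x : ℝ × ℝ} (h : RoughAt x0 y0 len N f v x) {a : Fin N × Fin N}
    (ha : S (wordMap x0 y0 len N (a :: v) x) ≠ 0) : RoughAt x0 y0 len N f (a :: v) x := by
  intro k
  have hN1 : (1 : ℝ) < N := by exact_mod_cast hN
  set c := |S (wordMap x0 y0 len N (a :: v) x)| with hc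
  have hc0 : 0 < c := abs_pos.2 ha
  obtain ⟨n, hn⟩ := pow_unbounded_of_one_lt (lamS * (2 * len) / (c / 2)) hN1
  obtain ⟨w, hw, hxw, hr⟩ := h (max k n)
  refine ⟨w, (le_max_left _ _).trans hw, hxw, ?_⟩
  refine IsRough.cons hsc hr (s := c / 2) (by positivity) fun t ht => ?_
  have hX := wordMap_mem_cell_append hxw (a :: v)
  have hD := cell_subset_sqD (x0 := x0) (y0 := y0) hlen (a :: (v ++ w))
  have h1 := hSlip _ (hD hX) _ (hD ht)
  have h2 := eudist_le_of_mem_cell _ hX ht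
  have h3 : 2 * len / (N : ℝ) ^ (a :: v ++ w).length ≤ 2 * len / (N : ℝ) ^ n := by
    gcongr
    · exact hN1.le
    · have := (le_max_right k n).trans hw
      simp only [List.cons_append, List.length_cons, List.length_append]
      omega
  have h4 : lamS * (2 * len / (N : ℝ) ^ n) ≤ c / 2 := by
    rw [div_lt_iff₀ (by positivity)] at hn
    rw [← mul_div_assoc, div_le_iff₀ (by positivity)]
    linarith
  have h5 : lamS * eudist (wordMap x0 y0 len N (a :: v) x) t ≤ c / 2 :=
    (mul_le_mul_of_nonneg_left (h2.trans h3) hlamS.le).trans h4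
  have h6 := abs_sub_abs_le_abs_sub (S (wordMap x0 y0 len N (a :: v) x)) (S t)
  linarith

theorem RoughAt.Lmap {x : ℝ × ℝ} {a : Fin N × Fin N} (h : RoughAt x0 y0 len N f [a] x) :
    RoughAt x0 y0 len N f [] (Lmap x0 y0 len N a x) := by
  intro k
  obtain ⟨w, hw, hx, hr⟩ := h k
  exact ⟨a :: w, hw.trans (by simp), ⟨x, hx, rfl⟩, hr⟩

theorem exists_roughAt (hlen : 0 < len) (h : IsRough x0 y0 len N f []) :
    ∃ x, RoughAt x0 y0 len N f [] x := by
  choose child hchild using fun w : {w // IsRough x0 y0 len N f w} => w.2.exists_append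
  let seq : ℕ → {w // IsRough x0 y0 len N f w} :=
    fun n => Nat.rec ⟨[], h⟩ (fun _ w => ⟨w.1 ++ [child w], hchild w⟩) n
  have hlength : ∀ n, (seq n).1.length = n := by
    intro n
    induction n with
    | zero => rfl
    | succ n ih =>
      change ((seq n).1 ++ [child (seq n)]).length = n + 1
      simp [ih]
  obtain ⟨x, hx⟩ := IsCompact.nonempty_iInter_of_sequence_nonempty_isCompact_isClosed
    (fun n => cell x0 y0 len N (seq n).1) (fun n => cell_append_subset hlen _ _)
    (fun n => (isConnected_cell hlen _).nonempty) (isCompact_cell _)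
    (fun n => (isCompact_cell _).isClosed)
  exact ⟨x, fun k => ⟨(seq k).1, (hlength k).ge, Set.mem_iInter.1 hx k, (seq k).2⟩⟩

theorem exists_ne_ne_zero_of_one_le_sum {ι : Type*} [Fintype ι] {g : ι → ℝ}
    (hg : ∀ i, |g i| < 1) (hsum : 1 ≤ ∑ i, |g i|) : ∃ i j, i ≠ j ∧ g i ≠ 0 ∧ g j ≠ 0 := by
  classical
  by_contra! hno
  by_cases h0 : ∃ i, g i ≠ 0
  · obtain ⟨i, hi⟩ := h0
    have : ∑ j, |g j| = |g i| :=
      Finset.sum_eq_single i (fun j _ hj => by simp [hno i j hj.symm hi]) (by simp)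
    linarith [hg i]
  · push Not at h0
    simp [h0] at hsum
    linarith

open Classical in
/-- Number of coordinates of a point of the square that are endpoints of the side. -/
noncomputable def endpointCount (x0 y0 len : ℝ) (t : ℝ × ℝ) : ℕ :=
  (if t.1 = x0 ∨ t.1 = x0 + len then 1 else 0) + (if t.2 = y0 ∨ t.2 = y0 + len then 1 else 0)

theorem endpointCount_lt_of_Lmap_eq (hlen : 0 < len) {a b : Fin N × Fin N} (hab : a ≠ b)
    {x : ℝ × ℝ} (hx : x ∈ sqD x0 y0 len)
    (h : Lmap x0 y0 len N a x = Lmap x0 y0 len N b x) :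
    endpointCount x0 y0 len (Lmap x0 y0 len N a x) < endpointCount x0 y0 len x := by
  have h1 := endpoint_of_uMap_endpoint hlen a.1 hx.1
  have h2 := endpoint_of_uMap_endpoint hlen a.2 hx.2
  have e1 : uMap x0 len N a.1 x.1 = uMap x0 len N b.1 x.1 := congrArg Prod.fst h
  have e2 : uMap y0 len N a.2 x.2 = uMap y0 len N b.2 x.2 := congrArg Prod.snd h
  unfold endpointCount
  change (if uMap x0 len N a.1 x.1 = x0 ∨ uMap x0 len N a.1 x.1 = x0 + len then 1 else 0) +
    (if uMap y0 len N a.2 x.2 = y0 ∨ uMap y0 len N a.2 x.2 = y0 + len then 1 else 0) < _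
  by_cases hab1 : a.1 = b.1
  · have hab2 : a.2 ≠ b.2 := fun h' => hab (Prod.ext hab1 h')
    obtain ⟨-, k1, k2, k3⟩ := uMap_eq_uMap_of_ne hlen hab2 hx.2 hx.2 e2
    have k4 : ¬(uMap y0 len N a.2 x.2 = y0 ∨ uMap y0 len N a.2 x.2 = y0 + len) := by
      rintro (h' | h') <;> linarith
    rw [if_pos k1, if_neg k4]
    split_ifs <;> first | omega | tauto
  · obtain ⟨-, k1, k2, k3⟩ := uMap_eq_uMap_of_ne hlen hab1 hx.1 hx.1 e1
    have k4 : ¬(uMap x0 len N a.1 x.1 = x0 ∨ uMap x0 len N a.1 x.1 = x0 + len) := by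
      rintro (h' | h') <;> linarith
    rw [if_pos k1, if_neg k4]
    split_ifs <;> first | omega | tauto

theorem infinite_of_Lmap_mem (hlen : 0 < len) {P : Set (ℝ × ℝ)} (hPD : P ⊆ sqD x0 y0 len)
    (hne : P.Nonempty)
    (hP : ∀ x ∈ P, ∃ a b : Fin N × Fin N, a ≠ b ∧ Lmap x0 y0 len N a x ∈ P ∧
      Lmap x0 y0 len N b x ∈ P) : P.Infinite := by
  intro hfin
  have : Nonempty (Fin N × Fin N) := let ⟨x, hx⟩ := hne; let ⟨a, _⟩ := hP x hx; ⟨a⟩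
  choose! a b hab ha hb using hP
  have hcross : ∀ x ∈ P, ∀ y ∈ P, ∀ c d : Fin N × Fin N,
      Lmap x0 y0 len N c x = Lmap x0 y0 len N d y → x = y := fun x hx y hy c d h =>
    Prod.ext (eq_of_uMap_eq_uMap hlen (hPD hx).1 (hPD hy).1 (congrArg Prod.fst h))
      (eq_of_uMap_eq_uMap hlen (hPD hx).2 (hPD hy).2 (congrArg Prod.snd h))
  have hsurj : P ⊆ (fun x => Lmap x0 y0 len N (a x) x) '' P := by
    have hinj : Set.InjOn (fun x => Lmap x0 y0 len N (a x) x) P :=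
      fun x hx y hy h => hcross x hx y hy _ _ h
    exact (hfin.eq_of_subset_of_encard_le' (Set.image_subset_iff.2 ha)
      hinj.encard_image.ge).ge
  obtain ⟨x, hx, hmin⟩ := hfin.exists_minimalFor (endpointCount x0 y0 len) P hne
  have heq : Lmap x0 y0 len N (a x) x = Lmap x0 y0 len N (b x) x := by
    obtain ⟨y, hy, hyx⟩ := hsurj (hb x hx)
    obtain rfl := hcross y hy x hx _ _ hyx
    exact hyx
  have hlt := endpointCount_lt_of_Lmap_eq hlen (hab x hx) (hPD hx) heq
  exact absurd (hmin (ha x hx) hlt.le) (not_le.2 hlt)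

theorem infinite_setOf_roughAt (hlen : 0 < len) (hN : 2 ≤ N) {K lamS : ℝ}
    (hsc : OscSumScaling x0 y0 len N f S K) (hlamS : 0 < lamS)
    (hSlip : ∀ t₁ ∈ sqD x0 y0 len, ∀ t₂ ∈ sqD x0 y0 len, |S t₁ - S t₂| ≤ lamS * eudist t₁ t₂)
    (hzero : Set.Finite {t | t ∈ sqD x0 y0 len ∧ S t = 0})
    (hinf : {x | RoughAt x0 y0 len N f [] x}.Infinite) (v : List (Fin N × Fin N)) :
    {x | RoughAt x0 y0 len N f v x}.Infinite := by
  induction v with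
  | nil => exact hinf
  | cons a v ih =>
    have hbad : ((wordMap x0 y0 len N (a :: v)) ⁻¹'
        {t | t ∈ sqD x0 y0 len ∧ S t = 0}).Finite :=
      hzero.preimage (wordMap_injective _).injOn
    refine (ih.sdiff hbad).mono ?_
    rintro x ⟨hx, hxS⟩
    refine RoughAt.cons hlen hN hsc hlamS hSlip hx fun h0 => hxS ⟨?_, h0⟩
    obtain ⟨w, -, hxw, -⟩ := hx 0
    exact cell_subset_sqD hlen _ (wordMap_mem_cell_append hxw (a :: v))

theorem isRough_of_one_le_sum (hlen : 0 < len) (hN : 2 ≤ N) {K lamS : ℝ}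
    (hsc : OscSumScaling x0 y0 len N f S K) (hlamS : 0 < lamS)
    (hSlip : ∀ t₁ ∈ sqD x0 y0 len, ∀ t₂ ∈ sqD x0 y0 len, |S t₁ - S t₂| ≤ lamS * eudist t₁ t₂)
    (hS1 : ∀ t ∈ sqD x0 y0 len, |S t| < 1)
    (hsum : ∀ t ∈ sqD x0 y0 len, 1 ≤ ∑ w : Fin N × Fin N, |S (Lmap x0 y0 len N w t)|)
    (hzero : Set.Finite {t | t ∈ sqD x0 y0 len ∧ S t = 0})
    (h : IsRough x0 y0 len N f []) (v : List (Fin N × Fin N)) : IsRough x0 y0 len N f v := by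
  have hinf : {x | RoughAt x0 y0 len N f [] x}.Infinite := by
    refine infinite_of_Lmap_mem (N := N) hlen (fun x hx => hx.mem_sqD hlen)
      (exists_roughAt hlen h) fun x hx => ?_
    have hxD := RoughAt.mem_sqD hlen hx
    obtain ⟨a, b, hab, ha, hb⟩ := exists_ne_ne_zero_of_one_le_sum
      (fun w => hS1 _ (Lmap_mem_sqD hlen w hxD)) (hsum x hxD)
    exact ⟨a, b, hab, (RoughAt.cons hlen hN hsc hlamS hSlip hx ha).Lmap,
      (RoughAt.cons hlen hN hsc hlamS hSlip hx hb).Lmap⟩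
  obtain ⟨x, hx⟩ :=
    (infinite_setOf_roughAt hlen hN hsc hlamS hSlip hzero hinf v).nonempty
  exact RoughAt.isRough hx

theorem isRough_of_ne_zero (hlen : 0 < len) {K : ℝ} (hsc : OscSumScaling x0 y0 len N f S K)
    (hS : ContinuousOn S (sqD x0 y0 len)) (hS0 : ∀ t ∈ sqD x0 y0 len, S t ≠ 0)
    (h : IsRough x0 y0 len N f []) (v : List (Fin N × Fin N)) : IsRough x0 y0 len N f v := by
  obtain ⟨t, ht, hmin⟩ := (isCompact_cell (x0 := x0) (y0 := y0) (len := len) (N := N) []).exists_isMinOn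
    (isConnected_cell hlen []).nonempty hS.abs
  induction v with
  | nil => exact h
  | cons a v ih =>
    exact ih.cons hsc (abs_pos.2 (hS0 t ht)) fun t' ht' => hmin (cell_subset_sqD hlen _ ht')

end Rough

section Growth

variable {x0 y0 len : ℝ} {N : ℕ} {f S : ℝ × ℝ → ℝ}

theorem infAbs_nonneg (S : ℝ × ℝ → ℝ) (E : Set (ℝ × ℝ)) : 0 ≤ infAbs S E :=
  Real.sInf_nonneg (by rintro _ ⟨t, -, rfl⟩; exact abs_nonneg _)

theorem infAbs_le {E : Set (ℝ × ℝ)} {t : ℝ × ℝ} (ht : t ∈ E) : infAbs S E ≤ |S t| :=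
  csInf_le ⟨0, by rintro _ ⟨t, -, rfl⟩; exact abs_nonneg _⟩ ⟨t, ht, rfl⟩

theorem lowMat_nonneg (m : ℕ) (i j : Fin (m + 1) → Fin N × Fin N) :
    0 ≤ lowMat x0 y0 len N S m i j := by
  unfold lowMat
  split_ifs
  exacts [infAbs_nonneg _ _, le_rfl]

theorem sum_lowMat_mul (m : ℕ) (i : Fin (m + 1) → Fin N × Fin N)
    (V : (Fin (m + 1) → Fin N × Fin N) → ℝ) :
    ∑ j, lowMat x0 y0 len N S m i j * V j =
      ∑ b : Fin N × Fin N, infAbs S (cell x0 y0 len N (List.ofFn i ++ [b])) *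
        V (Fin.snoc (α := fun _ => Fin N × Fin N) (Fin.tail i) b) := by
  classical
  conv_lhs => rw [← (Fin.snocEquiv fun _ => Fin N × Fin N).sum_comp, Fintype.sum_prod_type]
  refine Finset.sum_congr rfl fun b _ => ?_
  rw [Finset.sum_eq_single (Fin.tail i)]
  · simp [lowMat, Fin.snocEquiv, Fin.tail]
  · intro j _ hj
    have : ¬ ∀ k : Fin m, i k.succ =
        (Fin.snoc (α := fun _ => Fin N × Fin N) j b : Fin (m + 1) → _) k.castSucc := by
      intro h
      apply hj
      funext k
      simpa [Fin.tail] using (h k).symm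
    have h0 : lowMat x0 y0 len N S m i ((Fin.snocEquiv fun _ => Fin N × Fin N) (b, j)) = 0 :=
      if_neg this
    rw [h0, zero_mul]
  · simp

theorem sum_lowMat_mul_oscSum_le {K : ℝ} (hsc : OscSumScaling x0 y0 len N f S K) (m p : ℕ)
    (i : Fin (m + 1) → Fin N × Fin N) :
    ∑ j, lowMat x0 y0 len N S m i j * oscSum x0 y0 len N f (List.ofFn j) p ≤
      oscSum x0 y0 len N f (List.ofFn i) (p + 1) + (N : ℝ) ^ 2 * K * (N : ℝ) ^ p := by
  have hsum : ∑ _b : Fin N × Fin N, K * (N : ℝ) ^ p = (N : ℝ) ^ 2 * K * (N : ℝ) ^ p := by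
    simp; ring
  rw [sum_lowMat_mul, oscSum_succ, ← hsum, ← Finset.sum_add_distrib]
  refine Finset.sum_le_sum fun b _ => ?_
  have h1 : List.ofFn i ++ [b] = i 0 :: (List.ofFn (Fin.tail i) ++ [b]) := by
    rw [List.ofFn_succ]; rfl
  have h2 : List.ofFn (Fin.snoc (α := fun _ => Fin N × Fin N) (Fin.tail i) b :
      Fin (m + 1) → Fin N × Fin N) = List.ofFn (Fin.tail i) ++ [b] := by
    rw [List.ofFn_succ_last]; simp
  rw [h1, h2]
  exact hsc _ _ _ p (infAbs_nonneg _ _) fun t ht => infAbs_le ht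

/-- A nonnegative real matrix has a nonnegative left vector whose growth rate is at least any
number smaller than the spectral radius. -/
theorem exists_nonneg_mul_le_vecMul {α : Type*} [Fintype α] [DecidableEq α] {A : Matrix α α ℝ}
    (hA : ∀ i j, 0 ≤ A i j) {τ : ℝ} (hτ : ENNReal.ofReal τ < specRad A) :
    ∃ u : α → ℝ, (∀ i, 0 ≤ u i) ∧ (∃ i, 0 < u i) ∧ ∀ j, τ * u j ≤ ∑ i, u i * A i j := by
  unfold specRad spectralRadius at hτ
  simp only [lt_iSup_iff] at hτ
  obtain ⟨z, hz, hlt⟩ := hτ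
  have hτz : τ ≤ ‖z‖ := by
    have h1 : ENNReal.ofReal τ ≤ ENNReal.ofReal ‖z‖ := by
      rw [ofReal_norm]; exact hlt.le
    exact (ENNReal.ofReal_le_ofReal_iff (norm_nonneg _)).1 h1
  rw [spectrum.mem_iff, Matrix.isUnit_iff_isUnit_det, isUnit_iff_ne_zero, not_not,
    ← Matrix.exists_vecMul_eq_zero_iff] at hz
  obtain ⟨v, hv0, hv⟩ := hz
  refine ⟨fun i => ‖v i‖, fun i => norm_nonneg _, ?_, fun j => ?_⟩
  · obtain ⟨i, hi⟩ := Function.ne_iff.1 hv0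
    exact ⟨i, norm_pos_iff.2 hi⟩
  · have h1 : z * v j = ∑ i, v i * (A i j : ℂ) := by
      have h2 := congrFun hv j
      rw [Matrix.vecMul_sub, Algebra.algebraMap_eq_smul_one, Matrix.vecMul_smul,
        Matrix.vecMul_one] at h2
      simpa [sub_eq_zero, Matrix.vecMul, dotProduct] using h2
    calc τ * ‖v j‖ ≤ ‖z‖ * ‖v j‖ := by gcongr
      _ = ‖∑ i, v i * (A i j : ℂ)‖ := by rw [← norm_mul, h1]
      _ ≤ ∑ i, ‖v i * (A i j : ℂ)‖ := norm_sum_le _ _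
      _ = ∑ i, ‖v i‖ * A i j := by
        refine Finset.sum_congr rfl fun i _ => ?_
        rw [norm_mul, Complex.norm_real, Real.norm_of_nonneg (hA i j)]

/-- A sequence gaining a factor `τ > b` at each step, up to errors `K * b ^ p`, grows like `τ ^ p`
as soon as it once exceeds a certain multiple of `b ^ p`. -/
theorem exists_pos_mul_pow_le {φ : ℕ → ℝ} {τ b K : ℝ} (hτ : b < τ) (hτ0 : 0 < τ)
    (hb : 0 ≤ b) (hK : 0 ≤ K) (hφ : ∀ p, τ * φ p ≤ φ (p + 1) + K * b ^ p) {p₀ : ℕ}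
    (hp₀ : K / (τ - b) * b ^ p₀ < φ p₀) :
    ∃ c, 0 < c ∧ ∀ p, p₀ ≤ p → c * τ ^ p ≤ φ p := by
  have hd : 0 < τ - b := sub_pos.2 hτ
  set ψ : ℕ → ℝ := fun p => φ p - K / (τ - b) * b ^ p with hψ
  have hstep : ∀ p, τ * ψ p ≤ ψ (p + 1) := by
    intro p
    have h1 : K * b ^ p = τ * (K / (τ - b) * b ^ p) - K / (τ - b) * b ^ (p + 1) := by
      field_simp; ring
    simp only [hψ]
    linarith [hφ p]
  refine ⟨ψ p₀ / τ ^ p₀, div_pos (sub_pos.2 hp₀) (by positivity), fun p hp => ?_⟩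
  have h2 : ψ p₀ / τ ^ p₀ * τ ^ p ≤ ψ p := by
    induction p, hp using Nat.le_induction with
    | base => exact (div_mul_cancel₀ _ (by positivity)).le
    | succ p _ ih =>
      calc ψ p₀ / τ ^ p₀ * τ ^ (p + 1) = τ * (ψ p₀ / τ ^ p₀ * τ ^ p) := by ring
        _ ≤ τ * ψ p := by gcongr
        _ ≤ ψ (p + 1) := hstep p
  have h3 : 0 ≤ K / (τ - b) * b ^ p := by positivity
  simp only [hψ] at h2 ⊢
  linarith

theorem exists_pos_mul_pow_le_oscSum {K : ℝ} (hK : 0 ≤ K)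
    (hsc : OscSumScaling x0 y0 len N f S K) (hrough : ∀ v, IsRough x0 y0 len N f v)
    {m : ℕ} {τ : ℝ} (hτN : (N : ℝ) < τ)
    (hτ : ENNReal.ofReal τ < specRad (lowMat x0 y0 len N S m)) :
    ∃ c, 0 < c ∧ ∃ p₀ : ℕ, ∀ p, p₀ ≤ p → c * τ ^ p ≤ oscSum x0 y0 len N f [] p := by
  have hN : (0 : ℝ) ≤ N := N.cast_nonneg
  have hτ0 : 0 < τ := hN.trans_lt hτN
  obtain ⟨u, hu0, ⟨i₀, hi₀⟩, hu⟩ := exists_nonneg_mul_le_vecMul (lowMat_nonneg m) hτ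
  set V : (Fin (m + 1) → Fin N × Fin N) → ℕ → ℝ :=
    fun i p => oscSum x0 y0 len N f (List.ofFn i) p with hV
  have hV0 : ∀ i p, 0 ≤ V i p := fun i p => oscSum_nonneg _ _ _
  set U := ∑ i, u i with hU
  have hU0 : 0 < U := hi₀.trans_le
    (Finset.single_le_sum (f := u) (fun i _ => hu0 i) (Finset.mem_univ i₀))
  have hstep : ∀ p, τ * ∑ i, u i * V i p ≤
      ∑ i, u i * V i (p + 1) + U * ((N : ℝ) ^ 2 * K) * (N : ℝ) ^ p := by
    intro p
    calc τ * ∑ j, u j * V j p = ∑ j, τ * u j * V j p := by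
          rw [Finset.mul_sum]; exact Finset.sum_congr rfl fun _ _ => by ring
      _ ≤ ∑ j, (∑ i, u i * lowMat x0 y0 len N S m i j) * V j p :=
          Finset.sum_le_sum fun j _ => mul_le_mul_of_nonneg_right (hu j) (hV0 j p)
      _ = ∑ i, u i * ∑ j, lowMat x0 y0 len N S m i j * V j p := by
          simp only [Finset.sum_mul, Finset.mul_sum]
          rw [Finset.sum_comm]
          exact Finset.sum_congr rfl fun _ _ => Finset.sum_congr rfl fun _ _ => by ring
      _ ≤ ∑ i, u i * (V i (p + 1) + (N : ℝ) ^ 2 * K * (N : ℝ) ^ p) :=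
          Finset.sum_le_sum fun i _ =>
            mul_le_mul_of_nonneg_left (sum_lowMat_mul_oscSum_le hsc m p i) (hu0 i)
      _ = _ := by
          simp only [mul_add, Finset.sum_add_distrib, ← Finset.sum_mul, hU]
          ring
  obtain ⟨p₀, hp₀⟩ := hrough (List.ofFn i₀) (U * ((N : ℝ) ^ 2 * K) / (τ - N) / u i₀)
  have hbase : U * ((N : ℝ) ^ 2 * K) / (τ - N) * (N : ℝ) ^ p₀ < ∑ i, u i * V i p₀ := by
    have h1 := mul_lt_mul_of_pos_left hp₀ hi₀
    have h2 : u i₀ * V i₀ p₀ ≤ ∑ i, u i * V i p₀ :=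
      Finset.single_le_sum (f := fun i => u i * V i p₀)
        (fun i _ => mul_nonneg (hu0 i) (hV0 i p₀)) (Finset.mem_univ i₀)
    refine lt_of_eq_of_lt ?_ (h1.trans_le h2)
    field_simp
  obtain ⟨c, hc, hgrow⟩ := exists_pos_mul_pow_le hτN hτ0 hN (by positivity) hstep hbase
  refine ⟨c / U / τ ^ (m + 1), by positivity, p₀ + (m + 1), fun p hp => ?_⟩
  obtain ⟨k, rfl⟩ : ∃ k, p = m + 1 + k := ⟨p - (m + 1), by omega⟩
  have h1 : ∑ i, u i * V i k ≤ U * oscSum x0 y0 len N f [] (m + 1 + k) := by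
    rw [oscSum_add, Finset.mul_sum]
    refine Finset.sum_le_sum fun i _ => ?_
    have : u i ≤ U := Finset.single_le_sum (f := u) (fun i _ => hu0 i) (Finset.mem_univ i)
    exact mul_le_mul_of_nonneg_right this (hV0 i k)
  have h2 := (hgrow k (by omega)).trans h1
  rw [← div_le_iff₀' hU0] at h2
  refine le_trans (le_of_eq ?_) h2
  rw [pow_add τ (m + 1) k]
  field_simp

end Growth

section BoxCounting

open Filter Topology

/-- The grid cubes of side `ε`, indexed by their lower corners, that meet `E`. -/
def meetingCubes (E : Set (ℝ × ℝ × ℝ)) (ε : ℝ) : Set (ℤ × ℤ × ℤ) :=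
  {n : ℤ × ℤ × ℤ |
    (((Set.Icc ((n.1 : ℝ) * ε) (((n.1 : ℝ) + 1) * ε)) ×ˢ
      ((Set.Icc ((n.2.1 : ℝ) * ε) (((n.2.1 : ℝ) + 1) * ε)) ×ˢ
        (Set.Icc ((n.2.2 : ℝ) * ε) (((n.2.2 : ℝ) + 1) * ε)))) ∩ E).Nonempty}

theorem cubeCount_eq_ncard (E : Set (ℝ × ℝ × ℝ)) (ε : ℝ) :
    cubeCount E ε = (meetingCubes E ε).ncard :=
  Nat.card_coe_set_eq _

theorem mem_Icc_of_mem_cube_side {R ε : ℝ} (hε : 0 < ε) {x : ℝ} (hx : |x| ≤ R) {n : ℤ}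
    (h1 : n * ε ≤ x) (h2 : x ≤ (n + 1) * ε) :
    n ∈ Finset.Icc (-((⌈R / ε⌉₊ : ℤ) + 1)) ((⌈R / ε⌉₊ : ℤ) + 1) := by
  obtain ⟨hx1, hx2⟩ := abs_le.1 hx
  have hR : R / ε ≤ ⌈R / ε⌉₊ := Nat.le_ceil _
  have hR' : R ≤ ⌈R / ε⌉₊ * ε := (div_le_iff₀ hε).1 hR
  rw [Finset.mem_Icc]
  constructor
  · have : (-((⌈R / ε⌉₊ : ℝ) + 1)) * ε ≤ n * ε := by linarith
    exact_mod_cast le_of_mul_le_mul_right this hε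
  · have : (n : ℝ) * ε ≤ ((⌈R / ε⌉₊ : ℝ) + 1) * ε := by linarith
    exact_mod_cast le_of_mul_le_mul_right this hε

theorem meetingCubes_subset {E : Set (ℝ × ℝ × ℝ)} {R : ℝ}
    (hE : ∀ p ∈ E, |p.1| ≤ R ∧ |p.2.1| ≤ R ∧ |p.2.2| ≤ R) {ε : ℝ} (hε : 0 < ε) :
    meetingCubes E ε ⊆
      let I := Finset.Icc (-((⌈R / ε⌉₊ : ℤ) + 1)) ((⌈R / ε⌉₊ : ℤ) + 1)
      ((I ×ˢ (I ×ˢ I) : Finset (ℤ × ℤ × ℤ)) : Set (ℤ × ℤ × ℤ)) := by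
  rintro n ⟨p, ⟨⟨a1, a2⟩, ⟨b1, b2⟩, c1, c2⟩, hp⟩
  obtain ⟨e1, e2, e3⟩ := hE p hp
  rw [Finset.mem_coe, Finset.mem_product, Finset.mem_product]
  exact ⟨mem_Icc_of_mem_cube_side hε e1 a1 a2, mem_Icc_of_mem_cube_side hε e2 b1 b2,
    mem_Icc_of_mem_cube_side hε e3 c1 c2⟩

theorem finite_meetingCubes {E : Set (ℝ × ℝ × ℝ)} {R : ℝ}
    (hE : ∀ p ∈ E, |p.1| ≤ R ∧ |p.2.1| ≤ R ∧ |p.2.2| ≤ R) {ε : ℝ} (hε : 0 < ε) :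
    (meetingCubes E ε).Finite :=
  (Finset.finite_toSet _).subset (meetingCubes_subset hE hε)

theorem cubeCount_le {E : Set (ℝ × ℝ × ℝ)} {R : ℝ} (hR : 1 ≤ R)
    (hE : ∀ p ∈ E, |p.1| ≤ R ∧ |p.2.1| ≤ R ∧ |p.2.2| ≤ R) {ε : ℝ} (hε : 0 < ε) (hε1 : ε ≤ 1) :
    (cubeCount E ε : ℝ) ≤ (7 * R / ε) ^ 3 := by
  have h1 := Set.ncard_le_ncard (meetingCubes_subset hE hε) (Finset.finite_toSet _)
  rw [Set.ncard_coe_finset, ← cubeCount_eq_ncard, Finset.card_product, Finset.card_product,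
    Int.card_Icc] at h1
  set K := ⌈R / ε⌉₊
  have h2 : ((K : ℤ) + 1 + 1 - -((K : ℤ) + 1)).toNat = 2 * K + 3 := by omega
  rw [h2] at h1
  have h3 : (K : ℝ) < R / ε + 1 := Nat.ceil_lt_add_one (by positivity)
  have h4 : 1 ≤ R / ε := by rw [le_div_iff₀ hε]; linarith
  have h5 : (2 * K + 3 : ℝ) ≤ 7 * R / ε := by rw [mul_div_assoc]; linarith
  calc (cubeCount E ε : ℝ) ≤ (2 * K + 3) * ((2 * K + 3) * (2 * K + 3)) := by exact_mod_cast h1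
    _ = (2 * K + 3) ^ 3 := by ring
    _ ≤ (7 * R / ε) ^ 3 := by gcongr

theorem le_lbDim {E : Set (ℝ × ℝ × ℝ)} {R : ℝ} (hR : 1 ≤ R)
    (hE : ∀ p ∈ E, |p.1| ≤ R ∧ |p.2.1| ≤ R ∧ |p.2.2| ≤ R) {c d : ℝ} (hc : 0 < c)
    (h : ∀ᶠ ε in 𝓝[>] (0 : ℝ), c * (1 / ε) ^ d ≤ cubeCount E ε) : d ≤ lbDim E := by
  have hL : Tendsto (fun ε : ℝ => Real.log (1 / ε)) (𝓝[>] 0) atTop := by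
    simp only [one_div]
    exact Real.tendsto_log_atTop.comp tendsto_inv_nhdsGT_zero
  have hdiv : ∀ a b : ℝ, Tendsto (fun ε : ℝ => a / Real.log (1 / ε) + b) (𝓝[>] 0) (𝓝 b) := by
    intro a b
    simpa using (hL.const_div_atTop a).add_const b
  have hsmall : ∀ᶠ ε in 𝓝[>] (0 : ℝ), ε ∈ Set.Ioo (0 : ℝ) 1 := Ioo_mem_nhdsGT one_pos
  have hlower : ∀ᶠ ε in 𝓝[>] (0 : ℝ), Real.log c / Real.log (1 / ε) + d ≤
      Real.log (cubeCount E ε) / Real.log (1 / ε) := by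
    filter_upwards [h, hsmall] with ε hε ⟨h0, h1⟩
    have hpos : 0 < Real.log (1 / ε) := Real.log_pos (by rw [lt_div_iff₀ h0]; linarith)
    have hinv : 0 < 1 / ε := by positivity
    have hp : 0 < (1 / ε) ^ d := Real.rpow_pos_of_pos hinv d
    have := Real.log_le_log (by positivity) hε
    rw [Real.log_mul hc.ne' hp.ne', Real.log_rpow hinv] at this
    rw [le_div_iff₀ hpos, add_mul, div_mul_cancel₀ _ hpos.ne']
    exact this
  have hupper : ∀ᶠ ε in 𝓝[>] (0 : ℝ), Real.log (cubeCount E ε) / Real.log (1 / ε) ≤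
      3 * Real.log (7 * R) / Real.log (1 / ε) + 3 := by
    filter_upwards [h, hsmall] with ε hε ⟨h0, h1⟩
    have hpos : 0 < Real.log (1 / ε) := Real.log_pos (by rw [lt_div_iff₀ h0]; linarith)
    have hinv : 0 < 1 / ε := by positivity
    have hp : 0 < (1 / ε) ^ d := Real.rpow_pos_of_pos hinv d
    have := Real.log_le_log ((by positivity : 0 < c * (1 / ε) ^ d).trans_le hε)
      (cubeCount_le hR hE h0 h1.le)
    rw [div_eq_mul_one_div (7 * R), Real.log_pow,
      Real.log_mul (by positivity) hinv.ne'] at this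
    rw [div_le_iff₀ hpos, add_mul, div_mul_cancel₀ _ hpos.ne']
    push_cast at this
    linarith
  rw [← (hdiv (Real.log c) d).liminf_eq]
  exact liminf_le_liminf hlower (hdiv _ _).isBoundedUnder_ge
    ((hdiv _ _).isBoundedUnder_le.mono_le hupper).isCoboundedUnder_ge

theorem log_div_log_le_lbDim {E : Set (ℝ × ℝ × ℝ)} {R : ℝ} (hR : 1 ≤ R)
    (hE : ∀ p ∈ E, |p.1| ≤ R ∧ |p.2.1| ≤ R ∧ |p.2.2| ≤ R) {len : ℝ} (hlen : 0 < len)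
    {N : ℕ} (hN : 2 ≤ N) {c σ : ℝ} (hc : 0 < c) (hσ : 1 ≤ σ) {p₀ : ℕ}
    (h : ∀ p, p₀ ≤ p → ∀ ε, 0 < ε → ε ≤ len / (N : ℝ) ^ p → c * σ ^ p ≤ cubeCount E ε) :
    Real.log σ / Real.log N ≤ lbDim E := by
  have hN1 : (1 : ℝ) < N := by exact_mod_cast hN
  have hN0 : (0 : ℝ) < N := by positivity
  have hσ0 : 0 < σ := by positivity
  change Real.logb N σ ≤ lbDim E
  set d := Real.logb N σ with hd
  have hd0 : 0 ≤ d := Real.logb_nonneg hN1 hσ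
  have hNd : (N : ℝ) ^ d = σ := Real.rpow_logb hN0 hN1.ne' hσ0
  have hld : 0 < len ^ d := Real.rpow_pos_of_pos hlen d
  refine le_lbDim hR hE (c := c * len ^ d / σ) (by positivity) ?_
  have hsmall : ∀ᶠ ε in 𝓝[>] (0 : ℝ), ε ∈ Set.Ioo (0 : ℝ) (len / (N : ℝ) ^ p₀) :=
    Ioo_mem_nhdsGT (by positivity)
  filter_upwards [hsmall] with ε ⟨h0, h1⟩
  have h2 : (N : ℝ) ^ p₀ ≤ len / ε := by
    rw [le_div_iff₀ h0]
    rw [lt_div_iff₀ (by positivity)] at h1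
    linarith
  obtain ⟨p, hp1, hp2⟩ := exists_nat_pow_near ((one_le_pow₀ hN1.le).trans h2) hN1
  have hp : p₀ ≤ p := by
    by_contra hlt
    have : (N : ℝ) ^ (p + 1) ≤ (N : ℝ) ^ p₀ := pow_le_pow_right₀ hN1.le (by omega)
    linarith
  refine le_trans ?_ (h p hp ε h0 ?_)
  · have h3 : (len * (1 / ε)) ^ d ≤ σ ^ (p + 1) := by
      rw [mul_one_div, ← hNd, ← Real.rpow_natCast, ← Real.rpow_mul hN0.le, mul_comm d,
        Real.rpow_mul hN0.le, Real.rpow_natCast]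
      exact Real.rpow_le_rpow (by positivity) hp2.le hd0
    rw [Real.mul_rpow hlen.le (by positivity)] at h3
    calc c * len ^ d / σ * (1 / ε) ^ d = c / σ * (len ^ d * (1 / ε) ^ d) := by ring
      _ ≤ c / σ * σ ^ (p + 1) := by gcongr
      _ = c * σ ^ p := by rw [pow_succ]; field_simp
  · rw [le_div_iff₀ (by positivity)]
    rw [le_div_iff₀ h0] at hp1
    linarith

theorem exists_levels {f : ℝ × ℝ → ℝ} {E : Set (ℝ × ℝ)} (hE : IsCompact E) (hE' : IsConnected E)
    (hf : ContinuousOn f E) {ε : ℝ} (hε : 0 < ε) :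
    ∃ I : Finset ℤ, (∀ k ∈ I, ∃ t ∈ E, k * ε ≤ f t ∧ f t ≤ (k + 1) * ε) ∧ 1 ≤ I.card ∧
      oscil f E / ε ≤ I.card := by
  obtain ⟨a, ha, hamin⟩ := hE.exists_isMinOn hE'.nonempty hf
  obtain ⟨b, hb, hbmax⟩ := hE.exists_isMaxOn hE'.nonempty hf
  have hab : f a ≤ f b := hamin hb
  have hfl : ⌊f a / ε⌋ ≤ ⌊f b / ε⌋ := Int.floor_le_floor (by gcongr)
  have ha1 : ⌊f a / ε⌋ * ε ≤ f a := (le_div_iff₀ hε).1 (Int.floor_le _)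
  have ha2 : f a ≤ (⌊f a / ε⌋ + 1) * ε := ((div_lt_iff₀ hε).1 (Int.lt_floor_add_one _)).le
  have hb1 : ⌊f b / ε⌋ * ε ≤ f b := (le_div_iff₀ hε).1 (Int.floor_le _)
  refine ⟨Finset.Icc ⌊f a / ε⌋ ⌊f b / ε⌋, fun k hk => ?_, ?_, ?_⟩
  · obtain ⟨hk1, hk2⟩ := Finset.mem_Icc.1 hk
    rcases hk1.eq_or_lt with rfl | hlt
    · exact ⟨a, ha, ha1, ha2⟩
    · have h1 : f a ≤ k * ε := by
        refine ha2.trans ?_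
        gcongr
        exact_mod_cast hlt
      have h2 : k * ε ≤ f b := by
        refine le_trans ?_ hb1
        gcongr
      obtain ⟨t, ht, hft⟩ := hE'.isPreconnected.intermediate_value ha hb hf ⟨h1, h2⟩
      exact ⟨t, ht, hft.ge, by rw [hft]; linarith⟩
  · rw [Int.card_Icc]; omega
  · have h1 : oscil f E ≤ f b - f a := oscil_le hE'.nonempty fun s hs t ht =>
      sub_le_sub (hbmax hs) (hamin ht)
    have h2 : ((Finset.Icc ⌊f a / ε⌋ ⌊f b / ε⌋).card : ℝ) = ⌊f b / ε⌋ + 1 - ⌊f a / ε⌋ := by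
      rw [Int.card_Icc]
      have : (((⌊f b / ε⌋ + 1 - ⌊f a / ε⌋).toNat : ℤ) : ℝ) =
          ((⌊f b / ε⌋ + 1 - ⌊f a / ε⌋ : ℤ) : ℝ) := by rw [Int.toNat_of_nonneg (by omega)]
      push_cast at this
      exact_mod_cast this
    rw [h2]
    calc oscil f E / ε ≤ (f b - f a) / ε := by gcongr
      _ = f b / ε - f a / ε := sub_div _ _ _
      _ ≤ _ := by linarith [Int.lt_floor_add_one (f b / ε), Int.floor_le (f a / ε)]

theorem grid_mem_Icc {x0 h ε x : ℝ} {n g : ℤ} (hh : 0 < h) (hεh : ε ≤ h)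
    (hx1 : x0 + g * h ≤ x) (hx2 : x ≤ x0 + (g + 1) * h) (hn1 : n * ε ≤ x)
    (hn2 : x ≤ (n + 1) * ε) :
    g ∈ Finset.Icc (⌈(n * ε - x0) / h⌉ - 1) (⌈(n * ε - x0) / h⌉ + 1) := by
  rw [Finset.mem_Icc, sub_le_iff_le_add, Int.ceil_le, div_le_iff₀ hh]
  constructor
  · push_cast; linarith
  · have h1 : ((g : ℝ) - 1) ≤ (n * ε - x0) / h := by rw [le_div_iff₀ hh]; linarith
    have h2 := h1.trans (Int.le_ceil _)
    have : (g : ℝ) ≤ ⌈(n * ε - x0) / h⌉ + 1 := by linarith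
    exact_mod_cast this

variable {x0 y0 len : ℝ} {N : ℕ} {f : ℝ × ℝ → ℝ}

theorem sum_card_le_cubeCount (hlen : 0 < len) {p : ℕ} {ε : ℝ} (hε : 0 < ε)
    (hεp : ε ≤ len / (N : ℝ) ^ p)
    (hfin : (meetingCubes (graphOn f (sqD x0 y0 len)) ε).Finite)
    (I : (Fin p → Fin N × Fin N) → Finset ℤ)
    (hI : ∀ w, ∀ k ∈ I w, ∃ t ∈ cell x0 y0 len N (List.ofFn w), k * ε ≤ f t ∧ f t ≤ (k + 1) * ε) :
    ∑ w, (I w).card ≤ 9 * cubeCount (graphOn f (sqD x0 y0 len)) ε := by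
  classical
  choose! t ht htl htu using hI
  have hh : 0 < len / (N : ℝ) ^ p := hε.trans_le hεp
  rw [← Finset.card_sigma, cubeCount_eq_ncard, Set.ncard_eq_toFinset_card _ hfin]
  have hfl1 : ∀ x : ℝ, ⌊x / ε⌋ * ε ≤ x := fun x => (le_div_iff₀ hε).1 (Int.floor_le _)
  have hfl2 : ∀ x : ℝ, x ≤ (⌊x / ε⌋ + 1) * ε :=
    fun x => ((div_lt_iff₀ hε).1 (Int.lt_floor_add_one _)).le
  refine Finset.card_le_mul_card_image_of_maps_to
    (f := fun z : (_ : Fin p → Fin N × Fin N) × ℤ =>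
      (⌊(t z.1 z.2).1 / ε⌋, ⌊(t z.1 z.2).2 / ε⌋, z.2)) ?_ 9 ?_
  · rintro ⟨w, k⟩ hwk
    obtain ⟨-, hk⟩ := Finset.mem_sigma.1 hwk
    rw [Set.Finite.mem_toFinset]
    exact ⟨((t w k).1, (t w k).2, f (t w k)), ⟨⟨hfl1 _, hfl2 _⟩, ⟨hfl1 _, hfl2 _⟩,
      ⟨htl w k hk, htu w k hk⟩⟩, cell_subset_sqD hlen _ (ht w k hk), rfl⟩
  · rintro ⟨n₁, n₂, k⟩ -
    set J := fun (a : ℝ) (n : ℤ) => Finset.Icc (⌈(n * ε - a) / (len / (N : ℝ) ^ p)⌉ - 1)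
      (⌈(n * ε - a) / (len / (N : ℝ) ^ p)⌉ + 1) with hJ
    have hJc : ∀ a n, (J a n).card = 3 := by
      intro a n
      simp only [hJ, Int.card_Icc]
      omega
    have h9 : (J x0 n₁ ×ˢ J y0 n₂).card = 9 := by simp [Finset.card_product, hJc]
    rw [← h9]
    refine Finset.card_le_card_of_injOn
      (fun z => ((gridIdx ((List.ofFn z.1).map Prod.fst) : ℤ),
        (gridIdx ((List.ofFn z.1).map Prod.snd) : ℤ))) ?_ ?_
    · rintro ⟨w, k'⟩ hz
      simp only [Finset.coe_filter, Finset.mem_sigma, Finset.mem_univ, true_and,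
        Set.mem_ofPred_eq, Prod.mk.injEq] at hz
      obtain ⟨hk, rfl, rfl, rfl⟩ := hz
      obtain ⟨⟨a1, a2⟩, b1, b2⟩ := mem_cell_grid _ (ht w k' hk)
      rw [List.length_ofFn] at a1 a2 b1 b2
      simp only [Finset.coe_product, Set.mem_prod, Finset.mem_coe]
      exact ⟨grid_mem_Icc hh hεp (by exact_mod_cast a1) (by exact_mod_cast a2) (hfl1 _) (hfl2 _),
        grid_mem_Icc hh hεp (by exact_mod_cast b1) (by exact_mod_cast b2) (hfl1 _) (hfl2 _)⟩
    · rintro ⟨w, k₁⟩ hz ⟨w', k₂⟩ hz' heq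
      simp only [Finset.coe_filter, Finset.mem_sigma, Finset.mem_univ, true_and,
        Set.mem_ofPred_eq, Prod.mk.injEq] at hz hz'
      simp only [Prod.mk.injEq, Nat.cast_inj] at heq
      have e1 := gridIdx_injective (by simp) heq.1
      have e2 := gridIdx_injective (by simp) heq.2
      have hw : w = w' := by
        rw [List.map_ofFn, List.map_ofFn] at e1 e2
        have e1' := List.ofFn_injective e1
        have e2' := List.ofFn_injective e2
        funext i
        exact Prod.ext (congrFun e1' i) (congrFun e2' i)
      obtain ⟨-, -, -, rfl⟩ := hz
      obtain ⟨-, -, -, rfl⟩ := hz'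
      rw [hw]

theorem cubeCount_lower_bounds (hlen : 0 < len) (hf : ContinuousOn f (sqD x0 y0 len)) {p : ℕ}
    {ε : ℝ} (hε : 0 < ε) (hεp : ε ≤ len / (N : ℝ) ^ p)
    (hfin : (meetingCubes (graphOn f (sqD x0 y0 len)) ε).Finite) :
    ((N : ℝ) ^ 2) ^ p ≤ 9 * cubeCount (graphOn f (sqD x0 y0 len)) ε ∧
      oscSum x0 y0 len N f [] p / ε ≤ 9 * cubeCount (graphOn f (sqD x0 y0 len)) ε := by
  choose I hI hI1 hI2 using fun w : Fin p → Fin N × Fin N =>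
    exists_levels (isCompact_cell (x0 := x0) (y0 := y0) (len := len) (List.ofFn w))
      (isConnected_cell hlen _) (hf.mono (cell_subset_sqD hlen _)) hε
  have hsum := sum_card_le_cubeCount hlen hε hεp hfin I hI
  constructor
  · have h1 : ∑ _w : Fin p → Fin N × Fin N, 1 ≤ ∑ w, (I w).card :=
      Finset.sum_le_sum fun w _ => hI1 w
    have h2 := h1.trans hsum
    simp only [Finset.sum_const, Finset.card_univ, Fintype.card_fun, Fintype.card_prod,
      Fintype.card_fin, smul_eq_mul, mul_one] at h2
    rw [pow_two]
    exact_mod_cast h2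
  · unfold oscSum
    rw [Finset.sum_div]
    have h3 : ∑ w, ((I w).card : ℝ) ≤ 9 * (cubeCount (graphOn f (sqD x0 y0 len)) ε : ℝ) := by
      rw [← Nat.cast_sum]
      have h4 := Nat.cast_le (α := ℝ).2 hsum
      rwa [Nat.cast_mul, Nat.cast_ofNat] at h4
    exact (Finset.sum_le_sum fun w _ => hI2 w).trans h3

theorem exists_bound_graphOn (hf : ContinuousOn f (sqD x0 y0 len)) :
    ∃ R : ℝ, 1 ≤ R ∧ ∀ p ∈ graphOn f (sqD x0 y0 len), |p.1| ≤ R ∧ |p.2.1| ≤ R ∧ |p.2.2| ≤ R := by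
  have hc : IsCompact (sqD x0 y0 len) := isCompact_Icc.prod isCompact_Icc
  obtain ⟨B, hB⟩ := hc.exists_bound_of_continuousOn hf
  obtain ⟨B', hB'⟩ := hc.exists_bound_of_continuousOn continuousOn_id
  refine ⟨max 1 (max B B'), le_max_left _ _, ?_⟩
  rintro ⟨x, y, z⟩ ⟨hxy, hz⟩
  simp only at hxy hz
  have h1 := hB' _ hxy
  rw [id, Prod.norm_def, max_le_iff] at h1
  refine ⟨?_, ?_, ?_⟩
  · exact h1.1.trans ((le_max_right _ _).trans (le_max_right _ _))
  · exact h1.2.trans ((le_max_right _ _).trans (le_max_right _ _))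
  · simp only [hz]
    exact (hB _ hxy).trans ((le_max_left _ _).trans (le_max_right _ _))

end BoxCounting

section LowerBoxDim

variable {x0 y0 len : ℝ} {N : ℕ} {f S : ℝ × ℝ → ℝ}

theorem continuousOn_of_eudist_lipschitz {E : Set (ℝ × ℝ)} {c : ℝ} (hc : 0 ≤ c)
    (h : ∀ t₁ ∈ E, ∀ t₂ ∈ E, |S t₁ - S t₂| ≤ c * eudist t₁ t₂) : ContinuousOn S E := by
  refine (LipschitzOnWith.of_dist_le_mul (K := (c * 2).toNNReal) fun s hs t ht => ?_).continuousOn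
  rw [Real.dist_eq, Real.coe_toNNReal _ (by positivity), mul_assoc]
  refine (h s hs t ht).trans (mul_le_mul_of_nonneg_left ?_ hc)
  refine (eudist_le_add_abs s t).trans ?_
  rw [two_mul, Prod.dist_eq, Real.dist_eq, Real.dist_eq]
  exact add_le_add (le_max_left _ _) (le_max_right _ _)

theorem two_le_lbDim (hlen : 0 < len) (hN : 2 ≤ N) (hf : ContinuousOn f (sqD x0 y0 len)) :
    2 ≤ lbDim (graphOn f (sqD x0 y0 len)) := by
  obtain ⟨R, hR, hE⟩ := exists_bound_graphOn hf
  have hN1 : (1 : ℝ) < N := by exact_mod_cast hN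
  have h := log_div_log_le_lbDim (c := 1 / 9) (σ := (N : ℝ) ^ 2) (p₀ := 0) hR hE hlen hN
    (by norm_num) (one_le_pow₀ hN1.le) fun p _ ε hε hεp => by
      have h1 := (cubeCount_lower_bounds hlen hf hε hεp (finite_meetingCubes hE hε)).1
      linarith
  rwa [Real.log_pow, mul_div_assoc, div_self (Real.log_pos hN1).ne', mul_one] at h

theorem one_add_log_div_log_le_lbDim (hlen : 0 < len) (hN : 2 ≤ N)
    (hf : ContinuousOn f (sqD x0 y0 len)) {c τ : ℝ} (hc : 0 < c) (hτ : 1 ≤ τ) {p₀ : ℕ}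
    (h : ∀ p, p₀ ≤ p → c * τ ^ p ≤ oscSum x0 y0 len N f [] p) :
    1 + Real.log τ / Real.log N ≤ lbDim (graphOn f (sqD x0 y0 len)) := by
  obtain ⟨R, hR, hE⟩ := exists_bound_graphOn hf
  have hN1 : (1 : ℝ) < N := by exact_mod_cast hN
  have hN0 : (0 : ℝ) < N := zero_lt_one.trans hN1
  have h := log_div_log_le_lbDim (c := c / len / 9) (σ := N * τ) (p₀ := p₀) hR hE hlen hN
    (by positivity) (one_le_mul_of_one_le_of_one_le hN1.le hτ) fun p hp ε hε hεp => by
      have h1 := (cubeCount_lower_bounds hlen hf hε hεp (finite_meetingCubes hE hε)).2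
      have h2 : c / len * (N * τ) ^ p ≤ oscSum x0 y0 len N f [] p / ε := by
        rw [le_div_iff₀ hε]
        calc c / len * (N * τ) ^ p * ε ≤ c / len * (N * τ) ^ p * (len / (N : ℝ) ^ p) := by gcongr
          _ = c * τ ^ p := by rw [mul_pow]; field_simp
          _ ≤ _ := h p hp
      linarith
  rwa [Real.log_mul hN0.ne' (by positivity), add_div, div_self (Real.log_pos hN1).ne'] at h

end LowerBoxDim

/-- under (A4) or (A5), if the oscillation sums grow superlinearly in N^p,
then dim_B̲ Γf ≥ 1 + log ρ_*/log N, where ρ_* = lim_n ρ(M̲_n). -/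
theorem lower_box_dim_ge (x0 y0 len : ℝ) (hlen : 0 < len) (N : ℕ) (hN : 2 ≤ N)
    (f S q : ℝ × ℝ → ℝ) (lamS lamq : ℝ) (hlamS : 0 < lamS) (hlamq : 0 < lamq)
    (hf : ContinuousOn f (sqD x0 y0 len))
    (hSlip : ∀ t₁ ∈ sqD x0 y0 len, ∀ t₂ ∈ sqD x0 y0 len, |S t₁ - S t₂| ≤ lamS * eudist t₁ t₂)
    (hS1 : ∀ t ∈ sqD x0 y0 len, |S t| < 1)
    (hqlip : ∀ t₁ ∈ sqD x0 y0 len, ∀ t₂ ∈ sqD x0 y0 len, |q t₁ - q t₂| ≤ lamq * eudist t₁ t₂)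
    (hself : ∀ w : Fin N × Fin N, ∀ t ∈ cell x0 y0 len N [w],
      f t = S t * f (LInv x0 y0 len N w t) + q t)
    (hA : ((∀ t ∈ sqD x0 y0 len, 1 ≤ ∑ w : Fin N × Fin N, |S (Lmap x0 y0 len N w t)|) ∧
            Set.Finite {t | t ∈ sqD x0 y0 len ∧ S t = 0}) ∨
          ((∀ t ∈ sqD x0 y0 len, 0 < S t) ∨ (∀ t ∈ sqD x0 y0 len, S t < 0)))
    (hunb : ∀ C : ℝ, ∃ᶠ p in Filter.atTop,
      C < oscSum x0 y0 len N f [] p / (N : ℝ) ^ p) :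
    ∀ rhoLow : ENNReal,
      Filter.Tendsto (fun m : ℕ => specRad (lowMat x0 y0 len N S m)) Filter.atTop (nhds rhoLow) →
      1 + Real.log rhoLow.toReal / Real.log (N : ℝ) ≤ lbDim (graphOn f (sqD x0 y0 len)) := by
  intro ρ hρ
  have hN1 : (1 : ℝ) < N := by exact_mod_cast hN
  have hlogN := Real.log_pos hN1
  obtain hle | hlt := le_or_gt ρ.toReal N
  · have h1 : Real.log ρ.toReal ≤ Real.log N := by
      obtain h0 | h0 := ENNReal.toReal_nonneg.eq_or_lt (b := ρ.toReal)
      · rw [← h0, Real.log_zero]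
        exact hlogN.le
      · exact Real.log_le_log h0 hle
    have h2 := two_le_lbDim hlen hN hf
    have h3 := (div_le_one hlogN).2 h1
    linarith
  have hsc : ∃ K, 0 ≤ K ∧ OscSumScaling x0 y0 len N f S K :=
    exists_oscSumScaling hlen hlamS.le hlamq.le hf hSlip hqlip hself
  obtain ⟨K, hK, hsc⟩ := hsc
  have hrough₀ : IsRough x0 y0 len N f [] := fun C => by
    obtain ⟨p, hp⟩ := (hunb C).exists
    exact ⟨p, (lt_div_iff₀ (by positivity)).1 hp⟩
  have hrough : ∀ v, IsRough x0 y0 len N f v := by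
    intro v
    rcases hA with ⟨hsum, hzero⟩ | hsign
    · exact isRough_of_one_le_sum hlen hN hsc hlamS hSlip hS1 hsum hzero hrough₀ v
    · refine isRough_of_ne_zero hlen hsc (continuousOn_of_eudist_lipschitz hlamS.le hSlip) ?_
        hrough₀ v
      rcases hsign with h | h
      · exact fun t ht => (h t ht).ne'
      · exact fun t ht => (h t ht).ne
  have hρ0 : 0 < ρ.toReal := zero_lt_one.trans (hN1.trans hlt)
  have hρtop : ρ ≠ ⊤ := (ENNReal.toReal_pos_iff.1 hρ0).2.ne
  have hcont : Filter.Tendsto (fun τ => 1 + Real.log τ / Real.log (N : ℝ))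
      (nhdsWithin ρ.toReal (Set.Iio ρ.toReal))
      (nhds (1 + Real.log ρ.toReal / Real.log (N : ℝ))) :=
    (((Real.continuousAt_log hρ0.ne').tendsto.mono_left nhdsWithin_le_nhds).div_const _).const_add _
  refine le_of_tendsto hcont ?_
  filter_upwards [Ioo_mem_nhdsLT hlt] with τ hτ
  have hτρ : ENNReal.ofReal τ < ρ := (ENNReal.ofReal_lt_iff_lt_toReal
    (zero_le_one.trans (hN1.trans hτ.1).le) hρtop).2 hτ.2
  obtain ⟨m, hm⟩ := (hρ.eventually (lt_mem_nhds hτρ)).exists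
  obtain ⟨c, hc, p₀, hp₀⟩ := exists_pos_mul_pow_le_oscSum hK hsc hrough hτ.1 hm
  exact one_add_log_div_log_le_lbDim hlen hN hf hc (hN1.trans hτ.1).le hp₀
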